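/- Let x ∈ X and ε ∈ (0,1). If t ≥ (1/γ)·log(1/ε), then the diagonal entry at position (C(x), C(x)) of the partial trace over the system X of E_t(|x⟩⟨x| ⊗ |1⟩⟨1|) is at least 1 − ε; that is, after evolving for time t ≥ (1/γ)·log(1/ε), measuring the ancilla qubit yields the clause value C(x) with probability at least 1 − ε. -/

import Mathlib

open Matrix Filter
open scoped Kronecker Topology

attribute [local instance] Matrix.normedAddCommGroup Matrix.normedSpace

noncomputable section

/-- The computational basis of `n` qubits, `X = {0,1}ⁿ`. -/
abbrev QubitBasis (n : ℕ) := Fin n → Bool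

/-- Evaluation of the 3-literal clause with indices `i₁ i₂ i₃` and bits `b₁ b₂ b₃`:
`C(x) = ¬(x i₁ = b₁ ∧ x i₂ = b₂ ∧ x i₃ = b₃)`. -/
def clauseEval {n : ℕ} (i₁ i₂ i₃ : Fin n) (b₁ b₂ b₃ : Bool) (x : QubitBasis n) : Bool :=
  ! (decide (x i₁ = b₁) && decide (x i₂ = b₂) && decide (x i₃ = b₃))

/-- The Lindblad operator `L = Π⁻ ⊗ σ⁻` attached to a clause `C`:
`L((x,a),(y,b)) = 1` iff `x = y`, `C(x) = false`, `a = false`, `b = true`. -/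
def jumpOp {n : ℕ} (C : QubitBasis n → Bool) :
    Matrix (QubitBasis n × Bool) (QubitBasis n × Bool) ℂ :=
  Matrix.of fun p q =>
    if p.1 = q.1 ∧ C p.1 = false ∧ p.2 = false ∧ q.2 = true then 1 else 0

/-- The Lindbladian `ℒ(ρ) = γ (L ρ L† − (1/2)(L†L ρ + ρ L†L))` as a linear endomorphism
of the matrix space. -/
def lindbladian {d : Type*} [Fintype d] [DecidableEq d] (γ : ℝ) (L : Matrix d d ℂ) :
    Matrix d d ℂ →ₗ[ℂ] Matrix d d ℂ :=
  (γ : ℂ) • ((LinearMap.mulRight ℂ Lᴴ).comp (LinearMap.mulLeft ℂ L)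
    - (1 / 2 : ℂ) • (LinearMap.mulLeft ℂ (Lᴴ * L) + LinearMap.mulRight ℂ (Lᴴ * L)))

/-- The evolution `E_t = exp(t·ℒ)`, the exponential of the endomorphism `ℒ`. -/
def evol {d : Type*} [Fintype d] [DecidableEq d]
    (L : Matrix d d ℂ →ₗ[ℂ] Matrix d d ℂ) (t : ℝ) :
    Matrix d d ℂ →L[ℂ] Matrix d d ℂ :=
  haveI : IsTopologicalRing (Matrix d d ℂ →L[ℂ] Matrix d d ℂ) :=
    @NonUnitalSeminormedRing.toIsTopologicalRing _
      (@ContinuousLinearMap.toSeminormedRing ℂ (Matrix d d ℂ) _ _ _).toNonUnitalSeminormedRing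
  NormedSpace.exp ((t : ℂ) • LinearMap.toContinuousLinearMap L)

/-- Partial trace over the system `X`: `(a,b) ↦ Σ_{x ∈ X} M((x,a),(x,b))`. -/
def ptraceSystem {n : ℕ} (M : Matrix (QubitBasis n × Bool) (QubitBasis n × Bool) ℂ) :
    Matrix Bool Bool ℂ :=
  Matrix.of fun a b => ∑ x : QubitBasis n, M (x, a) (x, b)

theorem exp_apply_eigen {E : Type*} [NormedAddCommGroup E] [NormedSpace ℂ E] [CompleteSpace E]
    (A : E →L[ℂ] E) (c : ℂ) (v : E) (h : A v = c • v) :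
    (NormedSpace.exp A) v = Complex.exp c • v := by
  have hp : ∀ k : ℕ, (A ^ k) v = c ^ k • v := by
    intro k
    induction k with
    | zero => simp
    | succ k ih =>
      rw [pow_succ', mul_apply_eq_comp, ih, map_smul, h, smul_smul, pow_succ]
  have h1 := NormedSpace.exp_series_hasSum_exp' (𝕂 := ℂ) A
  have h2 := (ContinuousLinearMap.apply ℂ E v).hasSum h1
  have h3 := (NormedSpace.exp_series_hasSum_exp' (𝕂 := ℂ) c).smul_const v
  rw [← Complex.exp_eq_exp_ℂ] at h3
  refine h2.unique ?_
  convert h3 using 2 with k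
  simp [hp, smul_smul]

theorem evol_apply_eigen {d : Type*} [Fintype d] [DecidableEq d]
    (L : Matrix d d ℂ →ₗ[ℂ] Matrix d d ℂ) (t : ℝ) (c : ℂ) (v : Matrix d d ℂ)
    (h : L v = c • v) : evol L t v = Complex.exp (t * c) • v := by
  refine exp_apply_eigen _ _ _ ?_
  show (t : ℂ) • L v = _
  rw [h, smul_smul]

theorem jump_mul_true {n : ℕ} (C : QubitBasis n → Bool) (x : QubitBasis n)
    (q : QubitBasis n × Bool) :
    jumpOp C * single (x, true) q 1 = if C x = false then single (x, false) q 1 else 0 := by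
  ext ⟨y, a⟩ r
  by_cases hr : r = q
  · subst hr
    by_cases hx : C x = false <;> by_cases hy : x = y <;> cases a <;>
      first
      | (subst hy; simp [jumpOp, single_apply, hx])
      | simp [jumpOp, single_apply, hx, hy, Ne.symm hy]
  · rw [mul_single_apply_of_ne _ _ _ _ _ hr]
    split_ifs <;> simp [single_apply, Ne.symm hr]

theorem jump_mul_false {n : ℕ} (C : QubitBasis n → Bool) (x : QubitBasis n)
    (q : QubitBasis n × Bool) :
    jumpOp C * single (x, false) q 1 = 0 := by
  ext ⟨y, a⟩ r
  by_cases hr : r = q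
  · subst hr
    simp [jumpOp]
  · rw [mul_single_apply_of_ne _ _ _ _ _ hr]
    simp

theorem jumpH_mul_false {n : ℕ} (C : QubitBasis n → Bool) (x : QubitBasis n)
    (q : QubitBasis n × Bool) (hx : C x = false) :
    (jumpOp C)ᴴ * single (x, false) q 1 = single (x, true) q 1 := by
  ext ⟨y, a⟩ r
  by_cases hr : r = q
  · subst hr
    by_cases hy : x = y <;> cases a <;>
      first
      | (subst hy; simp [jumpOp, single_apply, hx, conjTranspose_apply])
      | simp [jumpOp, single_apply, hx, hy, conjTranspose_apply]
  · rw [mul_single_apply_of_ne _ _ _ _ _ hr]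
    simp [single_apply, Ne.symm hr]

/-- The Lindbladian on a Hermitian matrix, in terms of products on the left. -/
theorem lindbladian_herm {d : Type*} [Fintype d] [DecidableEq d] (γ : ℝ) (L ρ : Matrix d d ℂ)
    (hρ : ρᴴ = ρ) :
    lindbladian γ L ρ = (γ : ℂ) • ((L * ρ) * Lᴴ
      - (1 / 2 : ℂ) • (Lᴴ * (L * ρ) + (Lᴴ * (L * ρ))ᴴ)) := by
  simp [lindbladian, hρ, Matrix.mul_assoc, conjTranspose_mul]

theorem lind_zero {d : Type*} [Fintype d] [DecidableEq d] (γ : ℝ) (L ρ : Matrix d d ℂ)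
    (hρ : ρᴴ = ρ) (h : L * ρ = 0) : lindbladian γ L ρ = 0 := by
  rw [lindbladian_herm _ _ _ hρ, h]; simp

theorem lind_true {n : ℕ} (γ : ℝ) (C : QubitBasis n → Bool) (x : QubitBasis n)
    (hx : C x = false) :
    lindbladian γ (jumpOp C) (single (x, true) (x, true) 1) =
      (γ : ℂ) • (single (x, false) (x, false) 1 - single (x, true) (x, true) 1) := by
  have h1 := jump_mul_true C x (x, true)
  rw [if_pos hx] at h1
  have h2 := jumpH_mul_false C x (x, true) hx
  have h3 : single (x, false) (x, true) (1 : ℂ) * (jumpOp C)ᴴ = single (x, false) (x, false) 1 := by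
    have := congrArg conjTranspose (jump_mul_true C x (x, false))
    rw [if_pos hx] at this
    simpa [conjTranspose_mul] using this
  rw [lindbladian_herm _ _ _ (by simp), h1, h2, h3]
  congr 2
  simp only [conjTranspose_single, star_one]
  rw [← two_smul ℂ, smul_smul]
  norm_num

/-- for `t ≥ (1/γ)·log(1/ε)`, measuring the ancilla after evolving
`|x⟩⟨x| ⊗ |1⟩⟨1|` yields the clause value `C(x)` with probability at least `1 − ε`. -/
theorem ancilla_measurement_success {n : ℕ} (hn : 1 ≤ n)
    (i₁ i₂ i₃ : Fin n) (h₁₂ : i₁ ≠ i₂) (h₁₃ : i₁ ≠ i₃) (h₂₃ : i₂ ≠ i₃)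
    (b₁ b₂ b₃ : Bool) (γ : ℝ) (hγ : 0 < γ)
    (C : QubitBasis n → Bool) (hC : C = clauseEval i₁ i₂ i₃ b₁ b₂ b₃)
    (x : QubitBasis n) (ε : ℝ) (hε0 : 0 < ε) (hε1 : ε < 1)
    (t : ℝ) (ht : (1 / γ) * Real.log (1 / ε) ≤ t) :
    1 - ε ≤ ((ptraceSystem
      (evol (lindbladian γ (jumpOp C)) t (single (x, true) (x, true) 1)))
        (C x) (C x)).re := by
  have hf := lind_zero γ (jumpOp C) (single (x, false) (x, false) 1) (by simp)
    (jump_mul_false C x _)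
  by_cases hx : C x = false
  · have h1 := lind_true γ C x hx
    have e0 := evol_apply_eigen (lindbladian γ (jumpOp C)) t 0 (single (x, false) (x, false) 1)
      (by rw [hf, zero_smul])
    have e1 := evol_apply_eigen (lindbladian γ (jumpOp C)) t (-γ)
      (single (x, true) (x, true) 1 - single (x, false) (x, false) 1)
      (by rw [map_sub, hf, h1, sub_zero, neg_smul, ← smul_neg, neg_sub])
    rw [map_sub, e0, sub_eq_iff_eq_add] at e1
    rw [e1, hx]
    have key : Real.exp (-(t * γ)) ≤ ε := by
      rw [← Real.le_log_iff_exp_le hε0]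
      rw [one_div, one_div, Real.log_inv, inv_mul_le_iff₀ hγ] at ht
      linarith
    have hc : Complex.exp ((t : ℂ) * -(γ : ℂ)) = ((Real.exp (-(t * γ)) : ℝ) : ℂ) := by
      push_cast; congr 1; ring
    rw [hc]
    have : ptraceSystem (((Real.exp (-(t * γ)) : ℝ) : ℂ) •
        (single (x, true) (x, true) 1 - single (x, false) (x, false) 1) +
        Complex.exp (t * 0) • single (x, false) (x, false) 1) false false
        = ((1 - Real.exp (-(t * γ)) : ℝ) : ℂ) := by
      simp [ptraceSystem, single_apply, Finset.sum_add_distrib, Finset.filter_eq]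
      ring
    rw [this, Complex.ofReal_re]
    linarith
  · have hx' : C x = true := by simpa using hx
    have e0 := evol_apply_eigen (lindbladian γ (jumpOp C)) t 0 (single (x, true) (x, true) 1)
      (by rw [zero_smul]; exact lind_zero _ _ _ (by simp) (by rw [jump_mul_true, if_neg hx]))
    rw [e0, hx']
    have : ptraceSystem (Complex.exp (t * 0) • single (x, true) (x, true) 1) true true = 1 := by
      simp [ptraceSystem, single_apply, Finset.filter_eq]
    rw [this, Complex.one_re]
    linarith
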